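/- For every x in the interval [1/3, 1/2], it holds that P(2x) + Q(1 − x) − x·ξ(x) ≥ R. -/

import Mathlib

open Real

noncomputable def R : ℝ := 1 / (1 + Real.log 2)

noncomputable def f (x : ℝ) : ℝ :=
  if x ≤ R then 1/2 else (2 * Real.exp 1) ^ (x - 1)

noncomputable def F (x : ℝ) : ℝ :=
  if x ≤ R then x/2 else R * (2 * Real.exp 1) ^ (x - 1)

noncomputable def P (c : ℝ) : ℝ := ∫ y in (0:ℝ)..1, min (f y) c

noncomputable def Q (c : ℝ) : ℝ := ∫ y in (0:ℝ)..1, max (c - f y) 0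

noncomputable def xic : ℝ := (1 + (2/3) * Real.log (4/3)) * R - 2/3

noncomputable def phi : ℝ := (2/3) * xic / (2/3 - R + xic)

noncomputable def xi (x : ℝ) : ℝ :=
  if x ≤ 1/3 then xic / x else 9 * xic * (1 - 2 * x)

noncomputable def T (a b : ℝ) : ℝ := (a + b - 1/2) * (xi b - xi a)

noncomputable def pile (x : ℝ) : ℝ := max (2/3) (2 * x)

lemma R_pos : 0 < R := by
  have := Real.log_pos one_lt_two
  unfold R; positivity

lemma R_mul_one_add_log_two : R * (1 + Real.log 2) = 1 := by
  have := Real.log_pos one_lt_two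
  unfold R; field_simp

lemma two_mul_exp_one_rpow (x : ℝ) : (2 * Real.exp 1) ^ x = Real.exp (x / R) := by
  rw [Real.rpow_def_of_pos (by positivity), Real.log_mul two_ne_zero (Real.exp_ne_zero 1),
    Real.log_exp]
  congr 1
  have := Real.log_pos one_lt_two
  unfold R; field_simp; ring

lemma exp_sub_one_div_R_le_iff {c : ℝ} (hc : 0 < c) (y : ℝ) :
    Real.exp ((y - 1) / R) ≤ c ↔ y ≤ 1 + R * Real.log c := by
  rw [← Real.le_log_iff_exp_le hc, div_le_iff₀ R_pos, sub_le_iff_le_add', mul_comm]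

lemma one_add_R_mul_log_half : 1 + R * Real.log (1 / 2) = R := by
  rw [one_div, Real.log_inv]
  linarith [R_mul_one_add_log_two]

lemma f_eq_max (y : ℝ) : f y = max (1 / 2) (Real.exp ((y - 1) / R)) := by
  have h := exp_sub_one_div_R_le_iff (c := 1 / 2) (by norm_num) y
  rw [one_add_R_mul_log_half] at h
  unfold f
  rw [two_mul_exp_one_rpow]
  split_ifs with hy
  · rw [max_eq_left (h.2 hy)]
  · rw [max_eq_right (not_le.1 (mt h.1 hy)).le]

lemma continuous_f : Continuous f := by
  rw [funext f_eq_max]; fun_prop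

lemma integral_exp_sub_one_div_R (a b : ℝ) :
    ∫ y in a..b, Real.exp ((y - 1) / R) =
      R * Real.exp ((b - 1) / R) - R * Real.exp ((a - 1) / R) := by
  have hR := R_pos.ne'
  refine intervalIntegral.integral_eq_sub_of_hasDerivAt (f := fun y => R * Real.exp ((y - 1) / R))
    (fun y _ => ?_) (Continuous.intervalIntegrable (by fun_prop) _ _)
  have h := (((hasDerivAt_id' y).sub_const 1).div_const R).exp.const_mul R
  rwa [mul_left_comm, mul_one_div_cancel hR, mul_one] at h

lemma P_eq {c : ℝ} (h₁ : 1 / 2 ≤ c) (h₂ : c ≤ 1) : P c = R * c * (1 - Real.log c) := by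
  have hc : 0 < c := by linarith
  have hR := R_pos
  set z := 1 + R * Real.log c with hz
  have hRz : R ≤ z := by
    have := mul_le_mul_of_nonneg_left (Real.log_le_log (by norm_num) h₁) hR.le
    linarith [one_add_R_mul_log_half]
  have hz1 : z ≤ 1 := by nlinarith [Real.log_nonpos hc.le h₂]
  have hint (a b : ℝ) : IntervalIntegrable (fun y => min (f y) c) MeasureTheory.volume a b :=
    (continuous_f.min continuous_const).intervalIntegrable a b
  have hhalf (y : ℝ) : Real.exp ((y - 1) / R) ≤ 1 / 2 ↔ y ≤ R := by
    rw [exp_sub_one_div_R_le_iff (by norm_num), one_add_R_mul_log_half]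
  have hexpR : Real.exp ((R - 1) / R) = 1 / 2 := by
    rw [← Real.exp_log (show (0 : ℝ) < 1 / 2 by norm_num)]
    congr 1
    rw [div_eq_iff hR.ne']
    linarith [one_add_R_mul_log_half]
  have hexpz : Real.exp ((z - 1) / R) = c := by
    rw [hz, add_sub_cancel_left, mul_div_cancel_left₀ _ hR.ne', Real.exp_log hc]
  have i₁ : ∫ y in (0 : ℝ)..R, min (f y) c = R / 2 := by
    rw [intervalIntegral.integral_congr (g := fun _ => (1 / 2 : ℝ))]
    · simp; ring
    · intro y hy
      rw [Set.uIcc_of_le hR.le] at hy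
      simp only [f_eq_max]
      rw [max_eq_left ((hhalf y).2 hy.2), min_eq_left h₁]
  have i₂ : ∫ y in R..z, min (f y) c = R * c - R / 2 := by
    rw [intervalIntegral.integral_congr (g := fun y => Real.exp ((y - 1) / R)),
      integral_exp_sub_one_div_R, hexpR, hexpz]
    · ring
    · intro y hy
      rw [Set.uIcc_of_le hRz] at hy
      have h : 1 / 2 ≤ Real.exp ((y - 1) / R) := by
        rw [← hexpR]
        have := hy.1
        gcongr
      simp only [f_eq_max]
      rw [max_eq_right h, min_eq_left ((exp_sub_one_div_R_le_iff hc y).2 hy.2)]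
  have i₃ : ∫ y in z..1, min (f y) c = (1 - z) * c := by
    rw [intervalIntegral.integral_congr (g := fun _ => c)]
    · simp
    · intro y hy
      rw [Set.uIcc_of_le hz1] at hy
      have h : c ≤ Real.exp ((y - 1) / R) := by
        rw [← hexpz]
        have := hy.1
        gcongr
      simp only [f_eq_max]
      exact min_eq_right (h.trans (le_max_right _ _))
  unfold P
  rw [← intervalIntegral.integral_add_adjacent_intervals (hint 0 R) (hint R 1),
    ← intervalIntegral.integral_add_adjacent_intervals (hint R z) (hint z 1), i₁, i₂, i₃]
  ring

lemma Q_eq (c : ℝ) : Q c = c - P c := by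
  unfold Q P
  have h (y : ℝ) : max (c - f y) 0 = c - min (f y) c := by
    rcases le_total (f y) c with h | h
    · rw [min_eq_left h, max_eq_left (by linarith)]
    · rw [min_eq_right h, max_eq_right (by linarith), sub_self]
  simp_rw [h]
  rw [intervalIntegral.integral_sub (by simp)
    ((continuous_f.min continuous_const).intervalIntegrable _ _)]
  simp

lemma mul_xi_eq {x : ℝ} (hx : 1 / 3 ≤ x) : x * xi x = 9 * xic * x * (1 - 2 * x) := by
  unfold xi
  split_ifs with h
  · obtain rfl : x = 1 / 3 := le_antisymm h hx
    ring
  · ring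

lemma xic_le : xic ≤ R / 15 := by
  have h := Real.le_log_one_add_of_nonneg (x := 1 / 2) (by norm_num)
  have h₁ : Real.log (4 / 3) = Real.log 2 - Real.log (1 + 1 / 2) := by
    rw [← Real.log_div (by norm_num) (by norm_num)]; norm_num
  have h₂ : xic = R * (1 / 3 - 2 / 3 * Real.log (1 + 1 / 2)) := by
    unfold xic
    rw [h₁]
    linear_combination (2 / 3) * R_mul_one_add_log_two
  rw [h₂, div_eq_mul_one_div]
  refine mul_le_mul_of_nonneg_left ?_ R_pos.le
  norm_num at h ⊢
  linarith

lemma log_combination_lower_bound {t : ℝ} (h₀ : 0 ≤ t) (h₁ : t ≤ 1 / 3) :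
    3 / 10 * t * (1 - t) ≤
      -t - (1 - t) * Real.log (1 - t) + (1 + t) / 2 * Real.log (1 + t) := by
  have ht : 0 < 1 - t := by linarith
  have a : t / 2 ≤ (1 + t) / 2 * Real.log (1 + t) := by
    have := Real.one_sub_inv_le_log_of_pos (show 0 < 1 + t by linarith)
    calc t / 2 = (1 + t) / 2 * (1 - (1 + t)⁻¹) := by field_simp; ring
      _ ≤ _ := by gcongr
  have b : 2 * t * (1 - t) / (2 - t) ≤ -((1 - t) * Real.log (1 - t)) := by
    have h := Real.le_log_one_add_of_nonneg (x := t / (1 - t)) (by positivity)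
    have e : 1 + t / (1 - t) = (1 - t)⁻¹ := by field_simp; ring
    rw [e, Real.log_inv] at h
    have h' := mul_le_mul_of_nonneg_left h ht.le
    have e' : (1 - t) * (2 * (t / (1 - t)) / (t / (1 - t) + 2)) = 2 * t * (1 - t) / (2 - t) := by
      have : 2 - t ≠ 0 := by linarith
      have : t / (1 - t) + 2 = (2 - t) / (1 - t) := by field_simp; ring
      rw [this]; field_simp
    linarith
  have c : 3 / 10 * t * (1 - t) + t / 2 ≤ 2 * t * (1 - t) / (2 - t) := by
    rw [le_div_iff₀ (by linarith)]
    have : 0 ≤ t * (4 - 6 * t - 3 * t ^ 2) := mul_nonneg h₀ (by nlinarith)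
    nlinarith [mul_nonneg h₀ (sq_nonneg t)]
  linarith

theorem stmt_17 : ∀ x ∈ Set.Icc (1/3 : ℝ) (1/2),
    P (2 * x) + Q (1 - x) - x * xi x ≥ R := by
  rintro x ⟨h₁, h₂⟩
  have hR := R_pos
  have hL := R_mul_one_add_log_two
  rw [Q_eq, P_eq (by linarith) (by linarith), P_eq (by linarith) (by linarith), mul_xi_eq h₁]
  have key := log_combination_lower_bound (t := 1 - 2 * x) (by linarith) (by linarith)
  rw [show 1 - (1 - 2 * x) = 2 * x by ring, show 1 + (1 - 2 * x) = 2 * (1 - x) by ring,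
    Real.log_mul (x := 2) (y := 1 - x) two_ne_zero (by linarith)] at key
  have hxi := mul_le_mul_of_nonneg_right xic_le
    (show 0 ≤ 9 * x * (1 - 2 * x) from mul_nonneg (by linarith) (by linarith))
  have hkey := mul_le_mul_of_nonneg_left key hR.le
  have hone : (1 - x) * (R * (1 + Real.log 2)) = 1 - x := by rw [hL, mul_one]
  linarith
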